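/- Let σ be a type of samples, Φ : σ → Prop, β a type of argument/result tuples of a fixed library function f occurring once in the query, arg : σ → β its tuple in each sample, and Rest : σ → Prop the conjunction of the equality constraints and the (fixed) specifications of all other library functions. Define SafeF (φ : β → Prop) := ∀ s, φ (arg s) → Rest s → Φ s. Call s a weakening sample for φ if Rest s ∧ Φ s ∧ ¬φ (arg s) and SafeF (fun b => φ b ∨ b = arg s). Assume SafeF φ and that every tuple is realizable: ∀ b : β, ∃ s, arg s = b ∧ Rest s. Then φ is a weakest safe specification for f — i.e., for every φ' with SafeF φ' and ∀ b, φ b → φ' b, also ∀ b, φ' b → φ b — if and only if there exists no weakening sample for φ. -/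

import Mathlib

/-- Theorem 5.1 (single application of `f`): assuming `φ` is safe and every tuple
is realizable, `φ` is a weakest safe specification of `f` iff there exists no
weakening sample for `φ`. -/
theorem weakest_safe_iff_no_weakening_sample
    {σ β : Type*} (Φ : σ → Prop) (arg : σ → β) (Rest : σ → Prop)
    (φ : β → Prop)
    (hφ : ∀ s, φ (arg s) → Rest s → Φ s)
    (hreal : ∀ b : β, ∃ s, arg s = b ∧ Rest s) :
    (∀ φ' : β → Prop,
        (∀ s, φ' (arg s) → Rest s → Φ s) → (∀ b, φ b → φ' b) → (∀ b, φ' b → φ b)) ↔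
      ¬ ∃ s, (Rest s ∧ Φ s ∧ ¬ φ (arg s)) ∧
          (∀ s', (φ (arg s') ∨ arg s' = arg s) → Rest s' → Φ s') := by
  constructor
  · rintro hweakest ⟨s, ⟨-, -, hneg⟩, hsafe⟩
    exact hneg (hweakest (fun b => φ b ∨ b = arg s) hsafe (fun _ => Or.inl) _ (Or.inr rfl))
  · intro hnone φ' hsafe _ b hb
    by_contra hneg
    obtain ⟨s, rfl, hs⟩ := hreal b
    refine hnone ⟨s, ⟨hs, hsafe s hb hs, hneg⟩, ?_⟩
    rintro s' (h | h) hs'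
    · exact hφ s' h hs'
    · exact hsafe s' (h ▸ hb) hs'
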